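/- For every real H ≥ 1, every squarefull positive integer r, and every ε > 0, the number of squarefull integers h ≤ H that are divisible by r is O_ε(r^ε · (H/r)^{1/2}). -/

import Mathlib

/-- A positive integer is squarefull (powerful) if p² ∣ n for every prime p ∣ n. -/
def Squarefull (n : ℕ) : Prop := ∀ p : ℕ, p.Prime → p ∣ n → p ^ 2 ∣ n

/-- The divisor function satisfies `τ(n) ≪ n ^ ε` for every `ε > 0`. -/
theorem exists_card_divisors_le_rpow (ε : ℝ) (hε : 0 < ε) :
    ∃ K : ℝ, 0 < K ∧ ∀ n : ℕ, n ≠ 0 → (n.divisors.card : ℝ) ≤ K * (n : ℝ) ^ ε := by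
  set δ : ℝ := 2 ^ ε - 1 with hδ_def
  have hδ : 0 < δ := by
    have := Real.one_lt_rpow (show (1 : ℝ) < 2 by norm_num) hε
    linarith
  set P : ℕ := ⌈(2 : ℝ) ^ (1 / ε)⌉₊
  have hK₁ : 1 ≤ 1 + 1 / δ := by
    have := one_div_pos.mpr hδ
    linarith
  have hlocal : ∀ p : ℕ, p.Prime → ∀ a : ℕ,
      ((a : ℝ) + 1) ≤ (if p < P then 1 + 1 / δ else 1) * ((p : ℝ) ^ ε) ^ a := by
    intro p hp a
    have hp2 : (2 : ℝ) ≤ p := by exact_mod_cast hp.two_le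
    split_ifs with h
    · have h1 : 1 + δ ≤ (p : ℝ) ^ ε := by
        have := Real.rpow_le_rpow (by norm_num) hp2 hε.le
        linarith
      have h2 : 1 + a * δ ≤ ((p : ℝ) ^ ε) ^ a :=
        (one_add_mul_le_pow (by linarith) a).trans (pow_le_pow_left₀ (by linarith) h1 a)
      calc (a : ℝ) + 1 ≤ (1 + 1 / δ) * (1 + a * δ) := by
            have h3 : (1 + 1 / δ) * (1 + a * δ) = a + 1 + (1 / δ + a * δ) := by
              field_simp
              ring
            rw [h3]
            have : 0 ≤ 1 / δ + a * δ := by positivity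
            linarith
        _ ≤ _ := mul_le_mul_of_nonneg_left h2 (by linarith)
    · have h1 : 1 + 1 ≤ (p : ℝ) ^ ε := by
        have h3 : (2 : ℝ) ^ (1 / ε) ≤ p :=
          (Nat.le_ceil _).trans (by exact_mod_cast not_lt.mp h)
        have := Real.rpow_le_rpow (by positivity) h3 hε.le
        rw [← Real.rpow_mul (by norm_num), one_div_mul_cancel hε.ne', Real.rpow_one] at this
        linarith
      have h2 : 1 + a * (1 : ℝ) ≤ ((p : ℝ) ^ ε) ^ a :=
        (one_add_mul_le_pow (by linarith) a).trans (pow_le_pow_left₀ (by linarith) h1 a)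
      linarith
  refine ⟨(1 + 1 / δ) ^ P, by positivity, fun n hn => ?_⟩
  have hn_rpow : (n : ℝ) ^ ε = ∏ p ∈ n.primeFactors, ((p : ℝ) ^ ε) ^ n.factorization p := by
    conv_lhs => rw [← Nat.prod_factorization_pow_eq_self hn]
    rw [Finsupp.prod, Nat.support_factorization, Nat.cast_prod,
      ← Real.finsetProd_rpow _ _ fun _ _ => by positivity]
    refine Finset.prod_congr rfl fun p _ => ?_
    rw [Nat.cast_pow, Real.rpow_pow_comm (by positivity)]
  have hconst : ∏ p ∈ n.primeFactors, (if p < P then 1 + 1 / δ else 1) ≤ (1 + 1 / δ) ^ P := by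
    rw [← Finset.prod_filter, Finset.prod_const]
    refine pow_le_pow_right₀ hK₁ ?_
    calc _ ≤ (Finset.range P).card := Finset.card_le_card fun p hp => by
          simpa using (Finset.mem_filter.mp hp).2
      _ = P := Finset.card_range P
  rw [Nat.card_divisors hn, hn_rpow]
  push_cast
  calc ∏ p ∈ n.primeFactors, ((n.factorization p : ℝ) + 1)
      ≤ ∏ p ∈ n.primeFactors,
          (if p < P then 1 + 1 / δ else 1) * ((p : ℝ) ^ ε) ^ n.factorization p :=
        Finset.prod_le_prod (fun _ _ => by positivity)
          fun p hp => hlocal p (Nat.prime_of_mem_primeFactors hp) _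
    _ ≤ _ := by
        rw [Finset.prod_mul_distrib]
        exact mul_le_mul_of_nonneg_right hconst (Finset.prod_nonneg fun _ _ => by positivity)

/-- The cofactor of a divisor `r` of a squarefull number is a divisor of `r` times a number of the
form `a ^ 2 * b ^ 3`. -/
theorem Squarefull.exists_eq_mul_sq_mul_cube {r m : ℕ} (hm : 0 < m)
    (h : Squarefull (r * m)) : ∃ d a b : ℕ, d ∣ r ∧ m = d * (a ^ 2 * b ^ 3) := by
  obtain ⟨c, e, rfl, hc⟩ := Nat.sq_mul_squarefree m
  have hd : 0 < c.gcd r := Nat.gcd_pos_of_pos_left _ (Nat.pos_of_ne_zero hc.ne_zero)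
  obtain ⟨b, hb⟩ := Nat.gcd_dvd_left c r
  have hbc : b ∣ c := ⟨_, hb.trans (mul_comm _ _)⟩
  have hprime : ∀ p ∈ b.primeFactors, p ∣ e := by
    intro p hp
    have hpp := Nat.prime_of_mem_primeFactors hp
    have hpb := Nat.dvd_of_mem_primeFactors hp
    have hpr : ¬ p ∣ r := fun hpr => by
      have hpd : p ∣ c.gcd r := Nat.dvd_gcd (hpb.trans hbc) hpr
      have hpc : p * p ∣ c := by
        rw [hb]
        exact mul_dvd_mul hpd hpb
      exact hpp.not_isUnit (hc p hpc)
    have h1 : p ^ 2 ∣ r * (e ^ 2 * c) :=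
      h p hpp (((hpb.trans hbc).mul_left _).mul_left _)
    have h2 : p ^ 2 ∣ e ^ 2 * c :=
      (((Nat.Prime.coprime_iff_not_dvd hpp).mpr hpr).pow_left 2).dvd_of_dvd_mul_left h1
    rw [sq, mul_comm (e ^ 2)] at h2
    exact hpp.dvd_of_dvd_pow (hc.dvd_of_squarefree_of_mul_dvd_mul_right h2)
  have hbe : b ∣ e := by
    rw [← Nat.prod_primeFactors_of_squarefree (hc.squarefree_of_dvd hbc)]
    exact Finset.prod_primes_dvd e
      (fun p hp => (Nat.prime_of_mem_primeFactors hp).prime) hprime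
  obtain ⟨a, rfl⟩ := hbe
  refine ⟨c.gcd r, a, b, Nat.gcd_dvd_right _ _, ?_⟩
  conv_lhs => rw [hb]
  ring

/-- The pairs `(b, a)` of positive integers with `b ≤ N` and `a ^ 2 * b ^ 3 ≤ X`. -/
noncomputable def sqMulCubePairs (N : ℕ) (X : ℝ) : Finset (Σ _ : ℕ, ℕ) :=
  (Finset.Icc 1 N).sigma fun b => Finset.Icc 1 ⌊(X / (b : ℝ) ^ 3) ^ ((1 : ℝ) / 2)⌋₊

theorem card_sqMulCubePairs_le (N : ℕ) {X : ℝ} (hX : 0 ≤ X) :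
    ((sqMulCubePairs N X).card : ℝ) ≤
      (∑' b : ℕ, 1 / (b : ℝ) ^ ((3 : ℝ) / 2)) * X ^ ((1 : ℝ) / 2) := by
  have hsum : Summable fun b : ℕ => 1 / (b : ℝ) ^ ((3 : ℝ) / 2) :=
    Real.summable_one_div_nat_rpow.mpr (by norm_num)
  rw [sqMulCubePairs, Finset.card_sigma]
  push_cast
  calc _ ≤ ∑ b ∈ Finset.Icc 1 N, 1 / (b : ℝ) ^ ((3 : ℝ) / 2) * X ^ ((1 : ℝ) / 2) := by
        refine Finset.sum_le_sum fun b _ => ?_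
        rw [Nat.card_Icc, Nat.add_sub_cancel]
        refine (Nat.floor_le (by positivity)).trans_eq ?_
        rw [Real.div_rpow hX (by positivity), ← Real.rpow_natCast, ← Real.rpow_mul (by positivity)]
        norm_num
        ring
    _ ≤ _ := by
        rw [← Finset.sum_mul]
        exact mul_le_mul_of_nonneg_right
          (hsum.sum_le_tsum _ fun _ _ => by positivity) (by positivity)

theorem mem_sqMulCubePairs {N a b : ℕ} {X : ℝ} (ha : 0 < a) (hb : 0 < b) (hbN : b ≤ N)
    (h : (a : ℝ) ^ 2 * (b : ℝ) ^ 3 ≤ X) : (⟨b, a⟩ : Σ _ : ℕ, ℕ) ∈ sqMulCubePairs N X := by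
  have hb' : (0 : ℝ) < (b : ℝ) ^ 3 := by positivity
  simp only [sqMulCubePairs, Finset.mem_sigma, Finset.mem_Icc]
  refine ⟨⟨hb, hbN⟩, ha, Nat.le_floor ?_⟩
  rw [← Real.sqrt_eq_rpow]
  exact Real.le_sqrt_of_sq_le ((le_div_iff₀ hb').mpr h)

open scoped Classical in
theorem card_squarefull_multiples_le {H : ℝ} (hH : 0 ≤ H) {r : ℕ} (hr : 0 < r) :
    ((Finset.Icc 1 ⌊H⌋₊).filter (fun h => Squarefull h ∧ r ∣ h)).card ≤
      r.divisors.card * (sqMulCubePairs ⌊H⌋₊ (H / r)).card := by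
  rw [← Finset.card_product]
  refine (Finset.card_le_card fun h hh => ?_).trans
    (Finset.card_image_le (f := fun t : ℕ × (Σ _ : ℕ, ℕ) => r * (t.1 * (t.2.2 ^ 2 * t.2.1 ^ 3))))
  obtain ⟨hIcc, hfull, m, rfl⟩ := Finset.mem_filter.mp hh
  obtain ⟨hpos, hle⟩ := Finset.mem_Icc.mp hIcc
  have hm : 0 < m := Nat.pos_of_mul_pos_left hpos
  obtain ⟨d, a, b, hdr, rfl⟩ := hfull.exists_eq_mul_sq_mul_cube hm
  have hd : 0 < d := Nat.pos_of_dvd_of_pos hdr hr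
  have ha : 0 < a := Nat.pos_of_ne_zero fun ha => by simp [ha] at hm
  have hb : 0 < b := Nat.pos_of_ne_zero fun hb => by simp [hb] at hm
  have hab : a ^ 2 * b ^ 3 ≤ d * (a ^ 2 * b ^ 3) := Nat.le_mul_of_pos_left _ hd
  have hbN : b ≤ ⌊H⌋₊ := calc
    b ≤ b ^ 3 := Nat.le_self_pow (by norm_num) b
    _ ≤ a ^ 2 * b ^ 3 := Nat.le_mul_of_pos_left _ (by positivity)
    _ ≤ d * (a ^ 2 * b ^ 3) := hab
    _ ≤ r * (d * (a ^ 2 * b ^ 3)) := Nat.le_mul_of_pos_left _ hr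
    _ ≤ ⌊H⌋₊ := hle
  refine Finset.mem_image.mpr ⟨(d, ⟨b, a⟩), Finset.mem_product.mpr
    ⟨Nat.mem_divisors.mpr ⟨hdr, hr.ne'⟩, mem_sqMulCubePairs ha hb hbN ?_⟩, rfl⟩
  rw [le_div_iff₀' (by exact_mod_cast hr)]
  have h1 : r * (a ^ 2 * b ^ 3) ≤ ⌊H⌋₊ := (Nat.mul_le_mul_left r hab).trans hle
  have h2 := (Nat.le_floor_iff hH).mp h1
  exact_mod_cast h2

open scoped Classical in
/-- For every ε > 0, the number of squarefull integers h ≤ H divisible by a given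
squarefull integer r is O_ε(r^ε · (H/r)^{1/2}). -/
theorem stmt4 :
    ∀ ε : ℝ, 0 < ε → ∃ C : ℝ, 0 < C ∧ ∀ H : ℝ, 1 ≤ H → ∀ r : ℕ, 0 < r → Squarefull r →
      (((Finset.Icc 1 ⌊H⌋₊).filter (fun h => Squarefull h ∧ r ∣ h)).card : ℝ)
        ≤ C * (r : ℝ) ^ ε * (H / (r : ℝ)) ^ ((1 : ℝ) / 2) := by
  intro ε hε
  obtain ⟨K, hK, hdiv⟩ := exists_card_divisors_le_rpow ε hε
  have hsum : Summable fun b : ℕ => 1 / (b : ℝ) ^ ((3 : ℝ) / 2) :=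
    Real.summable_one_div_nat_rpow.mpr (by norm_num)
  have hZ : 0 < ∑' b : ℕ, 1 / (b : ℝ) ^ ((3 : ℝ) / 2) :=
    hsum.tsum_pos (fun _ => by positivity) 1 (by norm_num)
  refine ⟨K * ∑' b : ℕ, 1 / (b : ℝ) ^ ((3 : ℝ) / 2), mul_pos hK hZ, fun H hH r hr _ => ?_⟩
  have hH0 : 0 ≤ H := by linarith
  calc _ ≤ (r.divisors.card : ℝ) * ((sqMulCubePairs ⌊H⌋₊ (H / r)).card : ℝ) := by
        exact_mod_cast card_squarefull_multiples_le hH0 hr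
    _ ≤ (K * (r : ℝ) ^ ε) *
          ((∑' b : ℕ, 1 / (b : ℝ) ^ ((3 : ℝ) / 2)) * (H / r) ^ ((1 : ℝ) / 2)) :=
        mul_le_mul (hdiv r hr.ne') (card_sqMulCubePairs_le _ (by positivity))
          (by positivity) (by positivity)
    _ = _ := by ring
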